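/- Let X ⊂ int(𝔸) be an essential annular continuum and assume that (V)₁ is unbounded from below and unbounded from above. Then there exist sequences (Lₙ)ₙ≥1 and (Rₙ)ₙ≥1 of real numbers with R₁ > 1, L₁ < 0, (Lₙ) decreasing with Lₙ → −∞, (Rₙ) increasing with Rₙ → +∞, such that: (i) if γ is a hair of V and (γ(1))₁ < Lₙ, then Rₙ ∈ (γ)₁; (ii) if γ is a hair of V and (γ(1))₁ > Rₙ, then Lₙ₋₁ ∈ (γ)₁ (for n ≥ 2). -/

import Mathlib

open Set Function MeasureTheory Filter Topology

noncomputable section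

/-- The vertical fiber `[-1,1]`. -/
abbrev II : Set ℝ := Set.Icc (-1 : ℝ) 1

/-- The universal cover `ℝ × [-1,1]` of the annulus. -/
abbrev Strip : Type := ℝ × II

/-- The compact annulus `(ℝ/ℤ) × [-1,1]`. -/
abbrev Ann : Type := AddCircle (1 : ℝ) × II

/-- The covering projection `π`. -/
def pr (z : Strip) : Ann := ((z.1 : AddCircle (1 : ℝ)), z.2)

/-- The deck transformation `T^k`. -/
def shiftPt (k : ℤ) (z : Strip) : Strip := (z.1 + k, z.2)

/-- `S + k`, the image of `S` under `T^k`. -/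
def shiftSet (k : ℤ) (S : Set Strip) : Set Strip := shiftPt k '' S

/-- `f` is isotopic to the identity. -/
def IsotopicToId (f : Ann → Ann) : Prop :=
  ∃ H : ℝ → Ann → Ann, Continuous (fun p : ℝ × Ann => H p.1 p.2) ∧
    (∀ t : ℝ, Function.Bijective (H t)) ∧ H 0 = id ∧ H 1 = f

/-- `F` is a lift of `f` commuting with the deck transformation. -/
def IsLift (f : Ann → Ann) (F : Strip → Strip) : Prop :=
  (∀ z, pr (F z) = f (pr z)) ∧ (∀ z, F (shiftPt 1 z) = shiftPt 1 (F z))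

/-- `X` is an essential annular continuum with complementary components `Um`, `Up`. -/
structure IsEAC (X Um Up : Set Ann) : Prop where
  compact : IsCompact X
  connected : IsConnected X
  inInterior : ∀ p ∈ X, ((p.2 : ℝ)) ∈ Set.Ioo (-1 : ℝ) 1
  hUm : Um = connectedComponentIn Xᶜ ((0 : AddCircle (1 : ℝ)), ⟨-1, le_rfl, by norm_num⟩)
  hUp : Up = connectedComponentIn Xᶜ ((0 : AddCircle (1 : ℝ)), ⟨1, by norm_num, le_rfl⟩)
  cover : Xᶜ = Um ∪ Up
  ne : Um ≠ Up

/-- An arc `γ : [0,1] → U ∪ {p}` with `γ([0,1)) ⊂ U` and `γ(1) = p`. -/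
def IsArcTo (U : Set Strip) (γ : unitInterval → Strip) (p : Strip) : Prop :=
  Continuous γ ∧ Function.Injective γ ∧ (∀ t, t ≠ 1 → γ t ∈ U) ∧ γ 1 = p

/-- `p` is accessible from `U`. -/
def AccFrom (U : Set Strip) (p : Strip) : Prop := ∃ γ, IsArcTo U γ p

/-- The order `≺` on accessible points, with access arcs starting on `ℝ × {b}`. -/
def PrecB (b : ℝ) (U : Set Strip) (x x' : Strip) : Prop :=
  ∃ γ γ' : unitInterval → Strip,
    IsArcTo U γ x ∧ IsArcTo U γ' x' ∧
    ((γ 0).2 : ℝ) = b ∧ ((γ' 0).2 : ℝ) = b ∧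
    Disjoint (range γ) (range γ') ∧ (γ 0).1 < (γ' 0).1

/-- `k = k(x,y)` is the unique integer with `T^k(y) ⪯ x ≺ T^{k+1}(y)`. -/
def AccIdxB (b : ℝ) (U : Set Strip) (x y : Strip) (k : ℤ) : Prop :=
  (shiftPt k y = x ∨ PrecB b U (shiftPt k y) x) ∧ PrecB b U x (shiftPt (k + 1) y)

/-- `ρ` is the prime end rotation number of the lift `F` as seen from `U`
(access arcs starting at height `b`): `k(Fⁿ(x), y)/n → ρ` for all accessible `x, y`. -/
def PrimeEndRotB (b : ℝ) (U Xt : Set Strip) (F : Strip → Strip) (ρ : ℝ) : Prop :=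
  ∀ x ∈ Xt, ∀ y ∈ Xt, AccFrom U x → AccFrom U y →
    ∀ k : ℕ → ℤ, (∀ n : ℕ, AccIdxB b U (F^[n] x) y (k n)) →
      Tendsto (fun n : ℕ => (k n : ℝ) / (n : ℝ)) atTop (𝓝 ρ)

/-- The measure-theoretic rotation set `ρ_mes(g̃, X)`, where `φ` is the displacement
function of the lift `g̃` (pushed down to the annulus). -/
def rotMes (g : Ann → Ann) (φ : Ann → ℝ) (X : Set Ann) : Set ℝ :=
  {r | ∃ μ : Measure Ann, IsProbabilityMeasure μ ∧ Measure.map g μ = μ ∧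
    μ Xᶜ = 0 ∧ ∫ a, φ a ∂μ = r}

/-- A point in the interior of the top boundary segment `(0,1) × {1}`. -/
def topSeg : Strip := ((1 : ℝ) / 2, ⟨1, by norm_num, le_rfl⟩)

/-- `β' = β ∖ {x₀} = {0} × (η, 1]`. -/
def betaP (η : ℝ) : Set Strip := {z : Strip | z.1 = 0 ∧ η < (z.2 : ℝ)}

/-- `η = max{y : (0,y) ∈ X̃}`. -/
def etaSpec (Xt : Set Strip) (η : ℝ) : Prop :=
  IsGreatest {y : ℝ | ∃ z ∈ Xt, z.1 = 0 ∧ (z.2 : ℝ) = y} η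

/-- The fundamental region `V`: the closure, relative to `Ũ₊`, of the connected
component of `Ũ₊ ∖ (β' ∪ (β' + 1))` containing the segment `(0,1) × {1}`. -/
def Vset (Utp : Set Strip) (η : ℝ) : Set Strip :=
  Utp ∩ closure (connectedComponentIn (Utp \ (betaP η ∪ shiftSet 1 (betaP η))) topSeg)

/-- A hair of `W`: an arc in `W` starting on `ℝ × {1}`. -/
def IsHair (W : Set Strip) (γ : unitInterval → Strip) : Prop :=
  Continuous γ ∧ Function.Injective γ ∧ ((γ 0).2 : ℝ) = 1 ∧ ∀ t, γ t ∈ W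

/-- `(γ)₁`, the projection of the image of `γ` to the first coordinate. -/
def proj1 (γ : unitInterval → Strip) : Set ℝ := range fun t => (γ t).1

/-- `(V + k)⁻ = ⋃_{j ≤ k} (V + j)`. -/
def VMinus (k : ℤ) (V : Set Strip) : Set Strip := ⋃ j ∈ Iic k, shiftSet j V

/-- `(V + k)⁺ = ⋃_{j ≥ k} (V + j)`. -/
def VPlus (k : ℤ) (V : Set Strip) : Set Strip := ⋃ j ∈ Ici k, shiftSet j V

/-- A crosscut of `Ũ₊`: an arc with endpoints on `X̃` and interior in `Ũ₊`. -/
def IsCrosscut (Utp Xt : Set Strip) (c : unitInterval → Strip) : Prop :=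
  Continuous c ∧ Function.Injective c ∧ c 0 ∈ Xt ∧ c 1 ∈ Xt ∧
    ∀ t, t ≠ 0 → t ≠ 1 → c t ∈ Utp

/-- `F^n` for `n : ℤ`. -/
def iterZ (F : Strip ≃ₜ Strip) (n : ℤ) : Strip → Strip := fun z => (F.toEquiv ^ n) z

end

lemma log_edge {α : Type*} [TopologicalSpace α] {S : Set α} (hS : IsPreconnected S)
    {L f : α → ℂ} (hL : ContinuousOn L S) (hf : ContinuousOn f S)
    (hLf : ∀ x ∈ S, Complex.exp (L x) = f x) {c : ℂ} (hc : ∀ x ∈ S, c * f x ∈ Complex.slitPlane)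
    {x y : α} (hx : x ∈ S) (hy : y ∈ S) :
    L x - L y = Complex.log (c * f x) - Complex.log (c * f y) := by
  have hc0 : ∀ x ∈ S, c * f x ≠ 0 := fun x hx => Complex.slitPlane_ne_zero (hc x hx)
  have h := Complex.isCoveringMap_exp.eqOn_of_comp_eqOn hS (g₁ := L)
    (g₂ := fun z => Complex.log (c * f z) + (L y - Complex.log (c * f y))) hL
    (((continuousOn_const.mul hf).clog hc).add continuousOn_const) ?_ hy (by ring)
  · rw [h hx]; ring
  · intro z hz
    simp only [Function.comp, Subtype.mk.injEq]
    rw [Complex.exp_add, Complex.exp_sub, Complex.exp_log (hc0 z hz), Complex.exp_log (hc0 y hy),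
      hLf z hz, hLf y hy]
    have h1 := hc0 y hy
    have := left_ne_zero_of_mul h1
    have := right_ne_zero_of_mul h1
    field_simp

lemma exists_log_square (f : unitInterval × unitInterval → ℂ) (hf : Continuous f)
    (h0 : ∀ p, f p ≠ 0) : ∃ L : unitInterval × unitInterval → ℂ, Continuous L ∧
      ∀ p, Complex.exp (L p) = f p := by
  let q : ℝ × ℝ → unitInterval × unitInterval := fun p =>
    (projIcc 0 1 zero_le_one p.1, projIcc 0 1 zero_le_one p.2)
  have hq : Continuous q := by
    have := continuous_projIcc (h := zero_le_one (α := ℝ))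
    exact (this.comp continuous_fst).prodMk (this.comp continuous_snd)
  have e := Complex.isCoveringMap_exp.existsUnique_continuousMap_lifts
    (⟨fun p => (⟨f (q p), h0 _⟩ : {z : ℂ // z ≠ 0}), by fun_prop⟩ :
      C(ℝ × ℝ, {z : ℂ // z ≠ 0})) (a₀ := (0,0)) (e₀ := Complex.log (f (q (0,0))))
    (by ext; simp [Complex.exp_log (h0 _)])
  obtain ⟨F, ⟨-, hF⟩, -⟩ := e
  refine ⟨fun p => F (p.1, p.2), by fun_prop, fun p => ?_⟩
  have := congrArg Subtype.val (congrFun hF ((p.1 : ℝ), (p.2 : ℝ)))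
  simpa [q] using this

lemma crossing (a g : unitInterval → ℂ) (ha : Continuous a) (hg : Continuous g)
    (hne : ∀ s t, a s ≠ g t) (h1 : ∀ t, (g t).im ≤ (a 0).im) (h2 : ∀ s, (a s).im ≤ (g 0).im)
    (h3 : (a 0).re < (g 0).re) (h4 : ∀ t, (g t).re < (a 1).re) (h5 : ∀ s, (g 1).re < (a s).re) :
    False := by
  obtain ⟨L, hL, hLf⟩ := exists_log_square (fun p => g p.2 - a p.1) (by fun_prop)
    (fun p => sub_ne_zero.2 (hne _ _).symm)
  have hI : (a 0).im = (g 0).im := le_antisymm (h2 0) (h1 0)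
  have e1 := log_edge (S := univ) (L := fun s => L (s, 0)) (f := fun s => g 0 - a s) (c := -Complex.I)
    isPreconnected_univ (by fun_prop) (by fun_prop) (fun s _ => hLf (s, 0)) (by
      intro s _
      rw [Complex.mem_slitPlane_iff]
      by_contra! h
      simp at h
      exact hne s 0 (Complex.ext (by linarith [h.2]) (by linarith [h.1, h2 s]))) (mem_univ 1) (mem_univ 0)
  have e2 := log_edge (S := univ) (L := fun t => L (1, t)) (f := fun t => g t - a 1) (c := -1)
    isPreconnected_univ (by fun_prop) (by fun_prop) (fun s _ => hLf (1, s)) (by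
      intro s _
      rw [Complex.mem_slitPlane_iff]
      left; simp [h4]) (mem_univ 1) (mem_univ 0)
  have e3 := log_edge (S := univ) (L := fun s => L (s, 1)) (f := fun s => g 1 - a s) (c := -1)
    isPreconnected_univ (by fun_prop) (by fun_prop) (fun s _ => hLf (s, 1)) (by
      intro s _
      rw [Complex.mem_slitPlane_iff]
      left; simp [h5]) (mem_univ 0) (mem_univ 1)
  have e4 := log_edge (S := univ) (L := fun t => L (0, t)) (f := fun t => g t - a 0) (c := Complex.I)
    isPreconnected_univ (by fun_prop) (by fun_prop) (fun s _ => hLf (0, s)) (by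
      intro s _
      rw [Complex.mem_slitPlane_iff]
      by_contra! h
      simp at h
      exact hne 0 s (Complex.ext (by linarith [h.2]) (by linarith [h.1, h1 s]))) (mem_univ 0) (mem_univ 1)
  replace e1 := congrArg Complex.im e1
  replace e2 := congrArg Complex.im e2
  replace e3 := congrArg Complex.im e3
  replace e4 := congrArg Complex.im e4
  simp only [Complex.sub_im, Complex.log_im] at e1 e2 e3 e4
  have hd : g 0 - a 0 = (((g 0).re - (a 0).re : ℝ) : ℂ) := by
    apply Complex.ext <;> simp [hI]
  have k1 : Complex.arg (-Complex.I * (g 0 - a 0)) = -(Real.pi / 2) := by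
    rw [hd, mul_comm, Complex.arg_real_mul _ (by linarith), Complex.arg_neg_I]
  have k2 : Complex.arg (Complex.I * (g 0 - a 0)) = (Real.pi / 2) := by
    rw [hd, mul_comm, Complex.arg_real_mul _ (by linarith), Complex.arg_I]
  have k3 : 0 ≤ Complex.arg (-Complex.I * (g 0 - a 1)) := by
    rw [Complex.arg_nonneg_iff]; simp; linarith [h4 0]
  have k4 : Complex.arg (Complex.I * (g 1 - a 0)) < 0 := by
    rw [Complex.arg_neg_iff]; simp; linarith [h5 0]
  have k5 : |Complex.arg (-1 * (g 1 - a 0))| < Real.pi / 2 := by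
    rw [Complex.abs_arg_lt_pi_div_two_iff]; left; simp [h5]
  have k6 : |Complex.arg (-1 * (g 0 - a 1))| < Real.pi / 2 := by
    rw [Complex.abs_arg_lt_pi_div_two_iff]; left; simp [h4]
  rw [abs_lt] at k5 k6
  linarith [k5.1, k6.2]

lemma pr_continuous : Continuous pr :=
  ((AddCircle.continuous_mk' (1 : ℝ)).comp continuous_fst).prodMk continuous_snd

lemma pr_open : IsOpenMap pr := by
  have h : IsOpenMap ((↑) : ℝ → AddCircle (1 : ℝ)) := QuotientAddGroup.isOpenMap_coe
  exact h.prodMap IsOpenMap.id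

lemma pr_surj : Function.Surjective pr := by
  rintro ⟨x, y⟩
  obtain ⟨x, rfl⟩ := QuotientAddGroup.mk_surjective x
  exact ⟨(x, y), rfl⟩

lemma pr_shift (k : ℤ) (z : Strip) : pr (shiftPt k z) = pr z := by
  simp only [pr, shiftPt, Prod.mk.injEq, and_true]
  rw [AddCircle.coe_add]
  have : ((k : ℝ) : AddCircle (1 : ℝ)) = 0 := by
    rw [AddCircle.coe_eq_zero_iff]; exact ⟨k, by simp⟩
  rw [this, add_zero]

lemma pr_eq {z w : Strip} (h : pr z = pr w) : ∃ k : ℤ, w = shiftPt k z := by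
  simp only [pr, Prod.mk.injEq] at h
  have h1 : ((w.1 - z.1 : ℝ) : AddCircle (1 : ℝ)) = 0 := by
    rw [AddCircle.coe_sub, h.1, sub_self]
  rw [AddCircle.coe_eq_zero_iff] at h1
  obtain ⟨k, hk⟩ := h1
  refine ⟨k, Prod.ext ?_ h.2.symm⟩
  simp only [shiftPt]
  simp at hk
  linarith

lemma shift_continuous (k : ℤ) : Continuous (shiftPt k) := by
  unfold shiftPt; fun_prop

lemma shift_shift (k l : ℤ) (z : Strip) : shiftPt k (shiftPt l z) = shiftPt (k + l) z := by
  simp only [shiftPt, Prod.mk.injEq, and_true]; push_cast; ring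

lemma shift_zero (z : Strip) : shiftPt 0 z = z := by
  simp [shiftPt]

lemma dist_shift (k : ℤ) (z w : Strip) : dist (shiftPt k z) (shiftPt k w) = dist z w := by
  simp [shiftPt, Prod.dist_eq]

/-- The retraction of the plane onto the strip. -/
noncomputable def retr (p : ℝ × ℝ) : Strip := (p.1, projIcc (-1) 1 (by norm_num) p.2)

lemma retr_continuous : Continuous retr :=
  continuous_fst.prodMk ((continuous_projIcc).comp continuous_snd)

lemma retr_surj : Function.Surjective retr := fun z => ⟨(z.1, z.2), by simp [retr]⟩

lemma retr_quot : IsQuotientMap retr := by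
  refine IsQuotientMap.of_comp (f := fun z : Strip => ((z.1, (z.2 : ℝ)) : ℝ × ℝ)) (by fun_prop)
    retr_continuous ?_
  have : retr ∘ (fun z : Strip => ((z.1, (z.2 : ℝ)) : ℝ × ℝ)) = id := by
    funext z; simp [retr]
  rw [this]
  exact IsQuotientMap.id

instance strip_lpc : LocallyPathConnectedSpace Strip := retr_quot.locallyPathConnectedSpace

instance ann_lpc : LocallyPathConnectedSpace Ann :=
  (pr_open.isQuotientMap pr_continuous pr_surj).locallyPathConnectedSpace

instance ann_conn : ConnectedSpace Ann :=
  ((pr_surj.comp retr_surj).connectedSpace (pr_continuous.comp retr_continuous))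

/-- A point on the top line. -/
def topP (x : ℝ) : Strip := (x, ⟨1, by norm_num, le_rfl⟩)

/-- A point on the bottom line. -/
def botP (x : ℝ) : Strip := (x, ⟨-1, le_rfl, by norm_num⟩)

lemma topP_continuous : Continuous topP := by unfold topP; fun_prop
lemma botP_continuous : Continuous botP := by unfold botP; fun_prop

lemma pc_absorb {α : Type*} [TopologicalSpace α] {F S : Set α} {x y : α} (hS : IsPreconnected S)
    (hSF : S ⊆ F) (hy : y ∈ S) (hyc : y ∈ connectedComponentIn F x) :
    S ⊆ connectedComponentIn F x := by
  rw [connectedComponentIn_eq hyc]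
  exact hS.subset_connectedComponentIn hy hSF

section EAC
variable {X Um Up : Set Ann}

lemma top_not_X (hX : IsEAC X Um Up) (x : ℝ) : pr (topP x) ∈ Xᶜ := by
  intro h
  have := (hX.inInterior _ h).2
  simp [pr, topP] at this

lemma bot_not_X (hX : IsEAC X Um Up) (x : ℝ) : pr (botP x) ∈ Xᶜ := by
  intro h
  have := (hX.inInterior _ h).1
  simp [pr, botP] at this

lemma top_Up (hX : IsEAC X Um Up) (x : ℝ) : pr (topP x) ∈ Up := by
  rw [hX.hUp]
  have h : IsPreconnected (range (pr ∘ topP)) :=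
    isPreconnected_range (pr_continuous.comp topP_continuous)
  refine h.subset_connectedComponentIn ⟨0, ?_⟩ ?_ ⟨x, rfl⟩
  · simp [pr, topP]
  · rintro _ ⟨y, rfl⟩; exact top_not_X hX y

lemma bot_Um (hX : IsEAC X Um Up) (x : ℝ) : pr (botP x) ∈ Um := by
  rw [hX.hUm]
  have h : IsPreconnected (range (pr ∘ botP)) :=
    isPreconnected_range (pr_continuous.comp botP_continuous)
  refine h.subset_connectedComponentIn ⟨0, ?_⟩ ?_ ⟨x, rfl⟩
  · simp [pr, botP]
  · rintro _ ⟨y, rfl⟩; exact bot_not_X hX y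

lemma Up_open (hX : IsEAC X Um Up) : IsOpen Up := by
  rw [hX.hUp]; exact hX.compact.isClosed.isOpen_compl.connectedComponentIn

lemma Um_open (hX : IsEAC X Um Up) : IsOpen Um := by
  rw [hX.hUm]; exact hX.compact.isClosed.isOpen_compl.connectedComponentIn

lemma U_disj (hX : IsEAC X Um Up) : Disjoint Um Up := by
  rw [Set.disjoint_left]
  intro z hm hp
  apply hX.ne
  rw [hX.hUm] at hm ⊢
  rw [hX.hUp] at hp ⊢
  rw [connectedComponentIn_eq hm, connectedComponentIn_eq hp]

lemma Up_sub (hX : IsEAC X Um Up) : Up ⊆ Xᶜ := by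
  rw [hX.cover]; exact subset_union_right

lemma K_eq (hX : IsEAC X Um Up) : Upᶜ = X ∪ Um := by
  have hd := U_disj hX
  rw [Set.disjoint_left] at hd
  have hc := hX.cover
  ext z
  have := Set.ext_iff.1 hc z
  have := @hd z
  simp only [mem_compl_iff, mem_union] at *
  tauto

lemma K_preconn (hX : IsEAC X Um Up) : IsPreconnected Upᶜ := by
  have hUm : IsPreconnected Um := by rw [hX.hUm]; exact isPreconnected_connectedComponentIn
  have hmX : Um ⊆ Xᶜ := by rw [hX.cover]; exact subset_union_left
  have hmeet : (closure Um ∩ X).Nonempty := by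
    by_contra h
    have hsub : closure Um ⊆ Xᶜ := fun z hz hzX => h ⟨z, hz, hzX⟩
    have h2 : closure Um ⊆ Um := by
      conv_rhs => rw [hX.hUm]
      have hb := bot_Um hX 0
      exact pc_absorb hUm.closure hsub (subset_closure hb) (hX.hUm ▸ hb)
    have hcl : IsClopen Um := ⟨isClosed_of_closure_subset h2, Um_open hX⟩
    rcases isClopen_iff.1 hcl with h3 | h3
    · have := bot_Um hX 0; rw [h3] at this; exact this
    · obtain ⟨p, hp⟩ := hX.connected.nonempty
      exact hmX (h3 ▸ mem_univ p) hp
  obtain ⟨p, hp, hpX⟩ := hmeet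
  have h1 : IsPreconnected (insert p Um) := hUm.subset_closure (subset_insert _ _)
    (insert_subset hp subset_closure)
  have h2 := h1.union p (mem_insert _ _) hpX hX.connected.isPreconnected
  rw [K_eq hX]
  convert h2 using 1
  ext z; simp only [mem_union, mem_insert_iff]
  constructor
  · tauto
  · rintro ((rfl | h) | h) <;> tauto

end EAC

/-- The strip inside the complex plane. -/
def toC (z : Strip) : ℂ := ⟨z.1, z.2⟩

lemma toC_continuous : Continuous toC := by
  have : toC = fun z : Strip => ((z.1 : ℝ) : ℂ) + ((z.2 : ℝ) : ℂ) * Complex.I := by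
    funext z; apply Complex.ext <;> simp [toC]
  rw [this]; fun_prop

@[simp] lemma toC_re (z : Strip) : (toC z).re = z.1 := rfl
@[simp] lemma toC_im (z : Strip) : (toC z).im = z.2 := rfl

lemma toC_inj {z w : Strip} (h : toC z = toC w) : z = w :=
  Prod.ext (congrArg Complex.re h) (Subtype.ext (congrArg Complex.im h))

lemma dist_le_toC (z w : Strip) : dist z w ≤ ‖toC z - toC w‖ := by
  rw [Prod.dist_eq]
  apply max_le
  · have := Complex.abs_re_le_norm (toC z - toC w)
    simpa [Real.dist_eq] using this
  · have := Complex.abs_im_le_norm (toC z - toC w)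
    simpa [Subtype.dist_eq, Real.dist_eq] using this

lemma toC_le_dist (z w : Strip) : ‖toC z - toC w‖ ≤ 2 * dist z w := by
  have h := Complex.norm_le_abs_re_add_abs_im (toC z - toC w)
  have h1 : |(toC z - toC w).re| ≤ dist z w := by
    rw [Prod.dist_eq]; refine le_trans ?_ (le_max_left _ _); simp [Real.dist_eq]
  have h2 : |(toC z - toC w).im| ≤ dist z w := by
    rw [Prod.dist_eq]; refine le_trans ?_ (le_max_right _ _); simp [Subtype.dist_eq, Real.dist_eq]
  linarith

/-- `z - w` has a continuous logarithm on `Z`. -/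
def HasLog (Z : Set Strip) (w : Strip) : Prop :=
  ∃ L : Strip → ℂ, ContinuousOn L Z ∧ ∀ z ∈ Z, Complex.exp (L z) = toC z - toC w

lemma hasLog_bot {Z : Set Strip} {x : ℝ} (hZ : ∀ z ∈ Z, (-1 : ℝ) < z.2) : HasLog Z (botP x) := by
  have hs : ∀ z ∈ Z, -Complex.I * (toC z - toC (botP x)) ∈ Complex.slitPlane := by
    intro z hz
    rw [Complex.mem_slitPlane_iff]; left
    have := hZ z hz
    simp [botP]; linarith
  refine ⟨fun z => Complex.log (-Complex.I * (toC z - toC (botP x))) + Complex.log Complex.I,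
    ContinuousOn.add (ContinuousOn.clog ?_ hs) continuousOn_const, ?_⟩
  · have := toC_continuous
    fun_prop
  · intro z hz
    rw [Complex.exp_add, Complex.exp_log (Complex.slitPlane_ne_zero (hs z hz)),
      Complex.exp_log Complex.I_ne_zero]
    linear_combination (-(toC z - toC (botP x))) * Complex.I_sq

lemma hasLog_near {Z : Set Strip} {w w' : Strip} {ε : ℝ} (hw : ∀ z ∈ Z, ε ≤ dist z w)
    (hww : dist w w' < ε / 2) (h : HasLog Z w) : HasLog Z w' := by
  obtain ⟨L, hL, hLe⟩ := h
  have hε : 0 < ε := by linarith [dist_nonneg (x := w) (y := w')]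
  have hn : ∀ z ∈ Z, toC z - toC w ≠ 0 := by
    intro z hz h0
    have := dist_le_toC z w
    rw [h0, norm_zero] at this
    linarith [hw z hz]
  have hs : ∀ z ∈ Z, (toC z - toC w') / (toC z - toC w) ∈ Complex.slitPlane := by
    intro z hz
    apply Complex.ball_one_subset_slitPlane
    rw [Metric.mem_ball, dist_eq_norm]
    have e : (toC z - toC w') / (toC z - toC w) - 1 = (toC w - toC w') / (toC z - toC w) := by
      have := hn z hz
      field_simp; ring
    rw [e, norm_div, div_lt_one (norm_pos_iff.2 (hn z hz))]
    linarith [toC_le_dist w w', dist_le_toC z w, hw z hz]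
  refine ⟨fun z => L z + Complex.log ((toC z - toC w') / (toC z - toC w)),
    hL.add (ContinuousOn.clog (ContinuousOn.div ?_ ?_ hn) hs), ?_⟩
  · exact (toC_continuous.sub continuous_const).continuousOn
  · exact (toC_continuous.sub continuous_const).continuousOn
  · intro z hz
    rw [Complex.exp_add, hLe z hz, Complex.exp_log (Complex.slitPlane_ne_zero (hs z hz))]
    have := hn z hz
    field_simp

lemma eilenberg {X Um Up : Set Ann} (hX : IsEAC X Um Up) {Z : Set Strip} (hZ : IsCompact Z)
    (hZU : Z ⊆ pr ⁻¹' Up) {w : Strip} (hw : pr w ∉ Up) : HasLog Z w := by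
  have hcl : IsClosed (pr ⁻¹' Up)ᶜ := ((Up_open hX).preimage pr_continuous).isClosed_compl
  obtain ⟨ε, hε0, hε⟩ : ∃ ε : ℝ, 0 < ε ∧ ∀ z ∈ Z, ∀ w : Strip, pr w ∉ Up → ε ≤ dist z w := by
    obtain ⟨r, hr, hrd⟩ := Metric.exists_pos_forall_lt_edist hZ hcl
      (disjoint_compl_right_iff_subset.2 hZU)
    refine ⟨r, hr, ?_⟩
    intro z hz w hw
    have := hrd z hz w hw
    rw [edist_dist, ← ENNReal.ofReal_coe_nnreal] at this
    exact (ENNReal.ofReal_lt_ofReal_iff_of_nonneg r.coe_nonneg).1 this |>.le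
  let G : Set Strip := {w | pr w ∉ Up ∧ ∀ n : ℤ, HasLog Z (shiftPt n w)}
  let N : Set Strip := {w | pr w ∉ Up ∧ ¬ ∀ n : ℤ, HasLog Z (shiftPt n w)}
  have hGN : ∀ w, pr w ∉ Up → w ∈ G ∨ w ∈ N := fun w hw => by
    by_cases h : ∀ n : ℤ, HasLog Z (shiftPt n w)
    · exact Or.inl ⟨hw, h⟩
    · exact Or.inr ⟨hw, h⟩
  have step : ∀ w w' : Strip, w ∈ G → pr w' ∉ Up → dist w w' < ε / 2 → w' ∈ G := by
    intro w w' hwG hw' hd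
    refine ⟨hw', fun n => hasLog_near (fun z hz => hε z hz _ ?_) ?_ (hwG.2 n)⟩
    · rw [pr_shift]; exact hwG.1
    · rw [dist_shift]; exact hd
  have hGs : ∀ (k : ℤ) w, w ∈ G → shiftPt k w ∈ G := by
    intro k w h
    refine ⟨by rw [pr_shift]; exact h.1, fun n => ?_⟩
    rw [shift_shift]; exact h.2 _
  by_contra hcon
  have hwN : w ∈ N := by
    refine ⟨hw, fun h => hcon ?_⟩
    have := h 0
    rwa [shift_zero] at this
  have hbG : botP 0 ∈ G := by
    refine ⟨fun h => (Set.disjoint_left.1 (U_disj hX)) (bot_Um hX 0) h, fun n => ?_⟩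
    have : shiftPt n (botP 0) = botP n := by simp [shiftPt, botP]
    rw [this]
    apply hasLog_bot
    intro z hz
    rcases lt_or_eq_of_le z.2.2.1 with h | h
    · exact h
    · exfalso
      have hzb : z = botP z.1 := Prod.ext rfl (Subtype.ext h.symm)
      have := hZU hz
      rw [hzb] at this
      exact (Set.disjoint_left.1 (U_disj hX)) (bot_Um hX _) this
  have hself : ∀ (S : Set Strip), S ⊆ Metric.thickening (ε / 4) S :=
    fun S => Metric.self_subset_thickening (by linarith) S
  have key := K_preconn hX (pr '' Metric.thickening (ε / 4) G) (pr '' Metric.thickening (ε / 4) N)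
    (pr_open _ Metric.isOpen_thickening) (pr_open _ Metric.isOpen_thickening) (by
      intro k hk
      obtain ⟨v, rfl⟩ := pr_surj k
      rcases hGN v hk with h | h
      · exact Or.inl ⟨v, hself _ h, rfl⟩
      · exact Or.inr ⟨v, hself _ h, rfl⟩)
    ⟨pr (botP 0), hbG.1, botP 0, hself _ hbG, rfl⟩ ⟨pr w, hw, w, hself _ hwN, rfl⟩
  obtain ⟨k, hk, ⟨u, hu, huk⟩, ⟨v, hv, hvk⟩⟩ := key
  obtain ⟨m, rfl⟩ := pr_eq (huk.trans hvk.symm)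
  rw [Metric.mem_thickening_iff] at hu hv
  obtain ⟨g, hg, hgu⟩ := hu
  obtain ⟨n, hn, hnv⟩ := hv
  have h1 : dist (shiftPt m g) (shiftPt m u) < ε / 4 := by rw [dist_shift, dist_comm]; exact hgu
  have h2 : dist (shiftPt m g) n < ε / 2 := by
    linarith [dist_triangle (shiftPt m g) (shiftPt m u) n]
  exact hn.2 (step _ _ (hGs m g hg) hn.1 h2).2

/-- The vertical segment shifted by j. -/
def Bset (η : ℝ) (j : ℤ) : Set Strip := {z : Strip | z.1 = j ∧ η < (z.2 : ℝ)}

lemma betaP_eq (η : ℝ) : betaP η = Bset η 0 := by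
  ext z; simp [betaP, Bset]

lemma shift_betaP_eq (η : ℝ) : shiftSet 1 (betaP η) = Bset η 1 := by
  ext z; simp only [shiftSet, betaP, Bset, shiftPt, mem_image, mem_ofPred_eq]
  constructor
  · rintro ⟨w, ⟨h1, h2⟩, rfl⟩
    exact ⟨by simp [h1], h2⟩
  · rintro ⟨h1, h2⟩
    exact ⟨(0, z.2), ⟨rfl, h2⟩, Prod.ext (by simp [h1]) rfl⟩

lemma Bset_preconn (η : ℝ) (h : -1 < η) (j : ℤ) : IsPreconnected (Bset η j) := by
  have : Bset η j = (fun y : ℝ => retr (j, y)) '' Ioc η 1 := by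
    ext z
    constructor
    · rintro ⟨h1, h2⟩
      exact ⟨z.2, ⟨h2, z.2.2.2⟩, Prod.ext (by simp [retr, h1]) (by simp [retr])⟩
    · rintro ⟨y, ⟨h1, h2⟩, rfl⟩
      refine ⟨rfl, ?_⟩
      simp only [retr]
      rw [projIcc_of_mem _ ⟨by linarith, h2⟩]
      exact h1
  rw [this]
  exact isPreconnected_Ioc.image _
    (retr_continuous.comp (continuous_const.prodMk continuous_id)).continuousOn

lemma Bset_closed_diff (η : ℝ) (j : ℤ) {U : Set Strip} (hU : IsOpen U)
    (hx : ∀ z : Strip, z.1 = j → (z.2 : ℝ) = η → z ∉ U) : IsOpen (U \ Bset η j) := by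
  have : U \ Bset η j = U ∩ {z : Strip | z.1 = j ∧ η ≤ (z.2 : ℝ)}ᶜ := by
    ext z
    simp only [Bset, Set.mem_sdiff, mem_inter_iff, mem_compl_iff, mem_ofPred_eq]
    constructor
    · rintro ⟨h1, h2⟩
      refine ⟨h1, fun h => ?_⟩
      rcases lt_or_eq_of_le h.2 with h3 | h3
      · exact h2 ⟨h.1, h3⟩
      · exact hx z h.1 h3.symm h1
    · rintro ⟨h1, h2⟩
      exact ⟨h1, fun h => h2 ⟨h.1, h.2.le⟩⟩
  rw [this]
  refine hU.inter (IsClosed.isOpen_compl (self := ?_))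
  exact (isClosed_eq continuous_fst continuous_const).inter
    (isClosed_le continuous_const (continuous_subtype_val.comp continuous_snd))

section Sides
variable {X Um Up : Set Ann} {η : ℝ}

/-- Left component. -/
def Lt (Up : Set Ann) (η : ℝ) (j : ℤ) : Set Strip :=
  connectedComponentIn (pr ⁻¹' Up \ Bset η j) (topP (j - 1 / 2))

/-- Right component. -/
def Rt (Up : Set Ann) (η : ℝ) (j : ℤ) : Set Strip :=
  connectedComponentIn (pr ⁻¹' Up \ Bset η j) (topP (j + 1 / 2))

lemma eta_mem (hη : etaSpec (pr ⁻¹' X) η) : ∃ w : Strip, pr w ∈ X ∧ w.1 = 0 ∧ (w.2 : ℝ) = η := by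
  obtain ⟨z, hz, h⟩ := hη.1
  exact ⟨z, hz, h⟩

lemma eta_bounds (hX : IsEAC X Um Up) (hη : etaSpec (pr ⁻¹' X) η) : -1 < η ∧ η < 1 := by
  obtain ⟨w, hw, -, h⟩ := eta_mem hη
  have := hX.inInterior _ hw
  rw [← h]; exact this

lemma eta_pt (hη : etaSpec (pr ⁻¹' X) η) (j : ℤ) (z : Strip) (h1 : z.1 = j)
    (h2 : (z.2 : ℝ) = η) : pr z ∈ X := by
  obtain ⟨w, hw, h0, h⟩ := eta_mem hη
  have : z = shiftPt j w := Prod.ext (by simp [shiftPt, h0, h1]) (Subtype.ext (by simp [shiftPt, h, h2]))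
  rw [this, pr_shift]; exact hw

lemma Bset_not_X (hη : etaSpec (pr ⁻¹' X) η) {j : ℤ} {z : Strip} (h : z ∈ Bset η j) :
    pr z ∉ X := by
  intro hz
  have h1 : (shiftPt (-j) z).1 = 0 := by simp [shiftPt, h.1]
  have := hη.2 ⟨shiftPt (-j) z, by rw [mem_preimage, pr_shift]; exact hz, h1, rfl⟩
  exact absurd h.2 (not_lt.2 this)

lemma top_B (hX : IsEAC X Um Up) (hη : etaSpec (pr ⁻¹' X) η) (j : ℤ) : topP j ∈ Bset η j :=
  ⟨rfl, (eta_bounds hX hη).2⟩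

lemma Bset_U (hX : IsEAC X Um Up) (hη : etaSpec (pr ⁻¹' X) η) (j : ℤ) :
    Bset η j ⊆ pr ⁻¹' Up := by
  have h := (Bset_preconn η (eta_bounds hX hη).1 j).image pr pr_continuous.continuousOn
  have h1 := top_Up hX j
  rw [← image_subset_iff]
  conv_rhs => rw [hX.hUp]
  refine pc_absorb h ?_ ⟨_, top_B hX hη j, rfl⟩ (hX.hUp ▸ h1)
  rintro _ ⟨z, hz, rfl⟩
  exact Bset_not_X hη hz

lemma side_open (hX : IsEAC X Um Up) (hη : etaSpec (pr ⁻¹' X) η) (j : ℤ) :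
    IsOpen (pr ⁻¹' Up \ Bset η j) :=
  Bset_closed_diff η j ((Up_open hX).preimage pr_continuous)
    fun z h1 h2 h3 => Up_sub hX h3 (eta_pt hη j z h1 h2)

lemma top_side (hX : IsEAC X Um Up) (j : ℤ) (x : ℝ) (h : x ≠ j) :
    topP x ∈ pr ⁻¹' Up \ Bset η j := ⟨top_Up hX x, fun h' => h h'.1⟩

lemma top_Lt (hX : IsEAC X Um Up) (j : ℤ) (x : ℝ) (h : x < j) : topP x ∈ Lt Up η j := by
  have hp : IsPreconnected (topP '' Iio (j : ℝ)) :=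
    isPreconnected_Iio.image _ topP_continuous.continuousOn
  refine hp.subset_connectedComponentIn ⟨_, ?_, rfl⟩ ?_ ⟨x, h, rfl⟩
  · simp
  · rintro _ ⟨y, hy, rfl⟩; exact top_side hX j y (ne_of_lt hy)

lemma top_Rt (hX : IsEAC X Um Up) (j : ℤ) (x : ℝ) (h : (j : ℝ) < x) : topP x ∈ Rt Up η j := by
  have hp : IsPreconnected (topP '' Ioi (j : ℝ)) :=
    isPreconnected_Ioi.image _ topP_continuous.continuousOn
  refine hp.subset_connectedComponentIn ⟨_, ?_, rfl⟩ ?_ ⟨x, h, rfl⟩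
  · simp
  · rintro _ ⟨y, hy, rfl⟩; exact top_side hX j y (ne_of_gt hy)

lemma Lt_Rt_disj (hX : IsEAC X Um Up) (hη : etaSpec (pr ⁻¹' X) η) (j : ℤ) :
    Disjoint (Lt Up η j) (Rt Up η j) := by
  rw [Set.disjoint_left]
  intro z hl hr
  have hab : Lt Up η j = Rt Up η j := by
    unfold Lt Rt at *
    rw [connectedComponentIn_eq hl, connectedComponentIn_eq hr]
  have ha : topP (j - 1 / 2) ∈ Lt Up η j := top_Lt hX j _ (by linarith)
  have hb : topP (j + 1 / 2) ∈ Lt Up η j := hab ▸ top_Rt hX j _ (by linarith)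
  have hop : IsOpen (Lt Up η j) := (side_open hX hη j).connectedComponentIn
  have hpc : IsPathConnected (Lt Up η j) :=
    hop.isConnected_iff_isPathConnected.1 ⟨⟨_, ha⟩, isPreconnected_connectedComponentIn⟩
  obtain ⟨p, hp⟩ := hpc.joinedIn _ ha _ hb
  have hpS : ∀ t, p t ∈ pr ⁻¹' Up \ Bset η j := fun t => connectedComponentIn_subset _ _ (hp t)
  set S1 : Set Strip := range p
  set S2 : Set Strip := topP '' Icc ((j : ℝ) - 1 / 2) (j + 1 / 2)
  let w : Strip := shiftPt j (eta_mem hη).choose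
  have hw := (eta_mem hη).choose_spec
  have hwX : pr w ∈ X := by rw [pr_shift]; exact hw.1
  have hw1 : w.1 = j := by simp [w, shiftPt, hw.2.1]
  have hw2 : (w.2 : ℝ) = η := hw.2.2
  have hη1 := (eta_bounds hX hη).2
  obtain ⟨L, hL, hLe⟩ := eilenberg hX (Z := S1 ∪ S2) (w := w)
    ((isCompact_range p.continuous).union (isCompact_Icc.image topP_continuous)) (by
      rintro _ (⟨t, rfl⟩ | ⟨x, -, rfl⟩)
      · exact (hpS t).1
      · exact top_Up hX x) (fun h => Up_sub hX h hwX)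
  have hcf : Continuous fun z => toC z - toC w := toC_continuous.sub continuous_const
  have m1 : topP (j - 1 / 2) ∈ S1 := ⟨0, p.source⟩
  have m2 : topP (j + 1 / 2) ∈ S1 := ⟨1, p.target⟩
  have m3 : topP (j - 1 / 2) ∈ S2 := ⟨_, ⟨le_rfl, by linarith⟩, rfl⟩
  have m4 : topP (j + 1 / 2) ∈ S2 := ⟨_, ⟨by linarith, le_rfl⟩, rfl⟩
  have e1 := log_edge (S := S1) (L := L) (f := fun z => toC z - toC w) (c := Complex.I)
    (isPreconnected_range p.continuous) (hL.mono subset_union_left) hcf.continuousOn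
    (fun z hz => hLe z (Or.inl hz)) (by
      rintro _ ⟨t, rfl⟩
      rw [Complex.mem_slitPlane_iff]
      by_contra! h
      simp [hw1, hw2] at h
      have h1 : (p t).1 = j := by linarith [h.2]
      rcases lt_or_eq_of_le h.1 with h2 | h2
      · exact (hpS t).2 ⟨h1, h2⟩
      · exact Up_sub hX (hpS t).1 (eta_pt hη j _ h1 h2.symm)) m2 m1
  have e2 := log_edge (S := S2) (L := L) (f := fun z => toC z - toC w) (c := -Complex.I)
    (isPreconnected_Icc.image _ topP_continuous.continuousOn) (hL.mono subset_union_right)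
    hcf.continuousOn (fun z hz => hLe z (Or.inr hz)) (by
      rintro _ ⟨x, -, rfl⟩
      rw [Complex.mem_slitPlane_iff]
      left
      simp [hw2, topP, hη1]) m4 m3
  replace e1 := congrArg Complex.im e1
  replace e2 := congrArg Complex.im e2
  simp only [Complex.sub_im, Complex.log_im] at e1 e2
  have k1 : 0 ≤ Complex.arg (Complex.I * (toC (topP (j + 1 / 2)) - toC w)) := by
    rw [Complex.arg_nonneg_iff]; simp [topP, hw1]
  have k2 : Complex.arg (Complex.I * (toC (topP (j - 1 / 2)) - toC w)) < 0 := by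
    rw [Complex.arg_neg_iff]; simp [topP, hw1]
  have k3 : Complex.arg (-Complex.I * (toC (topP (j + 1 / 2)) - toC w)) < 0 := by
    rw [Complex.arg_neg_iff]; simp [topP, hw1]
  have k4 : 0 ≤ Complex.arg (-Complex.I * (toC (topP (j - 1 / 2)) - toC w)) := by
    rw [Complex.arg_nonneg_iff]; simp [topP, hw1]
  linarith

lemma B_Lt (hX : IsEAC X Um Up) (hη : etaSpec (pr ⁻¹' X) η) {i j : ℤ} (h : i < j) :
    Bset η i ⊆ Lt Up η j := by
  refine pc_absorb (Bset_preconn η (eta_bounds hX hη).1 i) ?_ (top_B hX hη i)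
    (top_Lt hX j _ (by exact_mod_cast h))
  intro z hz
  refine ⟨Bset_U hX hη i hz, fun h' => ?_⟩
  have := hz.1.symm.trans h'.1
  exact absurd (by exact_mod_cast this) (ne_of_lt h)

lemma B_Rt (hX : IsEAC X Um Up) (hη : etaSpec (pr ⁻¹' X) η) {i j : ℤ} (h : j < i) :
    Bset η i ⊆ Rt Up η j := by
  refine pc_absorb (Bset_preconn η (eta_bounds hX hη).1 i) ?_ (top_B hX hη i)
    (top_Rt hX j _ (by exact_mod_cast h))
  intro z hz
  refine ⟨Bset_U hX hη i hz, fun h' => ?_⟩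
  have := hz.1.symm.trans h'.1
  exact absurd (by exact_mod_cast this) (ne_of_gt h)

lemma Lt_Lt (hX : IsEAC X Um Up) (hη : etaSpec (pr ⁻¹' X) η) {i j : ℤ} (h : i < j) :
    Lt Up η i ⊆ Lt Up η j := by
  have h' : (i : ℝ) < j := by exact_mod_cast h
  refine pc_absorb isPreconnected_connectedComponentIn ?_ (top_Lt hX i (i - 1 / 2) (by linarith))
    (top_Lt hX j _ (by linarith))
  intro z hz
  exact ⟨(connectedComponentIn_subset _ _ hz).1, fun hb =>
    Set.disjoint_left.1 (Lt_Rt_disj hX hη i) hz (B_Rt hX hη h hb)⟩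

lemma Rt_Rt (hX : IsEAC X Um Up) (hη : etaSpec (pr ⁻¹' X) η) {i j : ℤ} (h : j < i) :
    Rt Up η i ⊆ Rt Up η j := by
  have h' : (j : ℝ) < i := by exact_mod_cast h
  refine pc_absorb isPreconnected_connectedComponentIn ?_ (top_Rt hX i (i + 1 / 2) (by linarith))
    (top_Rt hX j _ (by linarith))
  intro z hz
  exact ⟨(connectedComponentIn_subset _ _ hz).1, fun hb =>
    Set.disjoint_left.1 (Lt_Rt_disj hX hη i) (B_Lt hX hη h hb) hz⟩

/-- The interior component. -/
def Dset (Up : Set Ann) (η : ℝ) : Set Strip :=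
  connectedComponentIn (pr ⁻¹' Up \ (Bset η 0 ∪ Bset η 1)) (topP (1 / 2))

lemma V_eq : Vset (pr ⁻¹' Up) η = pr ⁻¹' Up ∩ closure (Dset Up η) := by
  unfold Vset Dset
  rw [betaP_eq, ← shift_betaP_eq, betaP_eq]
  rfl

lemma D_dom_open (hX : IsEAC X Um Up) (hη : etaSpec (pr ⁻¹' X) η) :
    IsOpen (pr ⁻¹' Up \ (Bset η 0 ∪ Bset η 1)) := by
  have := (side_open hX hη 0).inter (side_open hX hη 1)
  convert this using 1
  ext z; simp only [Set.mem_sdiff, mem_union, mem_inter_iff]; tauto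

lemma top_D (hX : IsEAC X Um Up) : topP (1 / 2) ∈ Dset Up η := by
  apply mem_connectedComponentIn
  refine ⟨top_Up hX _, ?_⟩
  rintro (h | h)
  · have := h.1; norm_num [topP] at this
  · have := h.1; norm_num [topP] at this

lemma D_Lt (hX : IsEAC X Um Up) : Dset Up η ⊆ Lt Up η 1 :=
  pc_absorb isPreconnected_connectedComponentIn
    (fun z hz => ⟨(connectedComponentIn_subset _ _ hz).1,
      fun h => (connectedComponentIn_subset _ _ hz).2 (Or.inr h)⟩) (top_D hX)
    (top_Lt hX 1 _ (by norm_num))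

lemma D_Rt (hX : IsEAC X Um Up) : Dset Up η ⊆ Rt Up η 0 :=
  pc_absorb isPreconnected_connectedComponentIn
    (fun z hz => ⟨(connectedComponentIn_subset _ _ hz).1,
      fun h => (connectedComponentIn_subset _ _ hz).2 (Or.inl h)⟩) (top_D hX)
    (top_Rt hX 0 _ (by norm_num))

lemma V_cases (hX : IsEAC X Um Up) (hη : etaSpec (pr ⁻¹' X) η) {z : Strip}
    (hz : z ∈ Vset (pr ⁻¹' Up) η) : z ∈ Dset Up η ∨ z ∈ Bset η 0 ∨ z ∈ Bset η 1 := by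
  rw [V_eq] at hz
  by_contra! h
  have hzd : z ∈ pr ⁻¹' Up \ (Bset η 0 ∪ Bset η 1) := ⟨hz.1, by rintro (h' | h') <;> tauto⟩
  have hop : IsOpen (connectedComponentIn (pr ⁻¹' Up \ (Bset η 0 ∪ Bset η 1)) z) :=
    (D_dom_open hX hη).connectedComponentIn
  obtain ⟨y, hy1, hy2⟩ := mem_closure_iff.1 hz.2 _ hop (mem_connectedComponentIn hzd)
  apply h.1
  unfold Dset at *
  rw [connectedComponentIn_eq hy2, ← connectedComponentIn_eq hy1]
  exact mem_connectedComponentIn hzd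

lemma V_Lt (hX : IsEAC X Um Up) (hη : etaSpec (pr ⁻¹' X) η) {z : Strip}
    (hz : z ∈ Vset (pr ⁻¹' Up) η) : z ∈ Lt Up η 2 := by
  rcases V_cases hX hη hz with h | h | h
  · exact Lt_Lt hX hη (by norm_num) (D_Lt hX h)
  · exact B_Lt hX hη (by norm_num) h
  · exact B_Lt hX hη (by norm_num) h

lemma V_Rt (hX : IsEAC X Um Up) (hη : etaSpec (pr ⁻¹' X) η) {z : Strip}
    (hz : z ∈ Vset (pr ⁻¹' Up) η) : z ∈ Rt Up η (-1) := by
  rcases V_cases hX hη hz with h | h | h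
  · exact Rt_Rt hX hη (by norm_num) (D_Rt hX h)
  · exact B_Rt hX hη (by norm_num) h
  · exact B_Rt hX hη (by norm_num) h

lemma V_shift (hX : IsEAC X Um Up) (hη : etaSpec (pr ⁻¹' X) η) {z w : Strip}
    (hz : z ∈ Vset (pr ⁻¹' Up) η) (hw : w ∈ Vset (pr ⁻¹' Up) η) : z ≠ shiftPt 3 w := by
  rintro rfl
  refine Set.disjoint_left.1 (Lt_Rt_disj hX hη 2) (V_Lt hX hη hz) ?_
  have hp : IsPreconnected (shiftPt 3 '' Rt Up η (-1)) :=
    isPreconnected_connectedComponentIn.image _ (shift_continuous 3).continuousOn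
  refine pc_absorb hp ?_ ⟨topP 0, top_Rt hX (-1) 0 (by norm_num), rfl⟩ ?_
    ⟨w, V_Rt hX hη hw, rfl⟩
  · rintro _ ⟨v, hv, rfl⟩
    have hv' := connectedComponentIn_subset _ _ hv
    refine ⟨by rw [mem_preimage, pr_shift]; exact hv'.1, fun h => hv'.2 ⟨?_, h.2⟩⟩
    have := h.1
    simp [shiftPt] at this
    push_cast; linarith
  · have : shiftPt 3 (topP 0) = topP 3 := by simp [shiftPt, topP]
    rw [this]
    exact top_Rt hX 2 3 (by norm_num)

lemma V_top (hX : IsEAC X Um Up) (hη : etaSpec (pr ⁻¹' X) η) {z : Strip}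
    (hz : z ∈ Vset (pr ⁻¹' Up) η) (h1 : (z.2 : ℝ) = 1) : -1 ≤ z.1 ∧ z.1 ≤ 2 := by
  have hzt : z = topP z.1 := Prod.ext rfl (Subtype.ext h1)
  constructor
  · by_contra! h
    have := top_Lt (η := η) hX (-1) z.1 (by push_cast; exact h)
    rw [← hzt] at this
    exact Set.disjoint_left.1 (Lt_Rt_disj hX hη (-1)) this (V_Rt hX hη hz)
  · by_contra! h
    have := top_Rt (η := η) hX 2 z.1 (by push_cast; exact h)
    rw [← hzt] at this
    exact Set.disjoint_left.1 (Lt_Rt_disj hX hη 2) (V_Lt hX hη hz) this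

lemma D_V {z : Strip} (hz : z ∈ Dset Up η) : z ∈ Vset (pr ⁻¹' Up) η := by
  rw [V_eq]
  exact ⟨(connectedComponentIn_subset _ _ hz).1, subset_closure hz⟩

lemma D_path (hX : IsEAC X Um Up) (hη : etaSpec (pr ⁻¹' X) η) {d : Strip} (hd : d ∈ Dset Up η) :
    ∃ δ : unitInterval → Strip, Continuous δ ∧ δ 0 = topP (1 / 2) ∧ δ 1 = d ∧
      ∀ t, δ t ∈ Vset (pr ⁻¹' Up) η := by
  have hop : IsOpen (Dset Up η) := (D_dom_open hX hη).connectedComponentIn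
  have hpc : IsPathConnected (Dset Up η) :=
    hop.isConnected_iff_isPathConnected.1 ⟨⟨_, hd⟩, isPreconnected_connectedComponentIn⟩
  obtain ⟨p, hp⟩ := hpc.joinedIn _ (top_D hX) _ hd
  exact ⟨p, p.continuous, p.source, p.target, fun t => D_V (hp t)⟩

lemma keyA (hX : IsEAC X Um Up) (hη : etaSpec (pr ⁻¹' X) η)
    (habove : ¬ BddAbove (Prod.fst '' Vset (pr ⁻¹' Up) η)) (R : ℝ) :
    ∃ L0 : ℝ, ∀ γ : unitInterval → Strip, IsHair (Vset (pr ⁻¹' Up) η) γ →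
      (∀ t, (γ t).1 < R) → L0 ≤ (γ 1).1 := by
  rw [not_bddAbove_iff] at habove
  obtain ⟨_, ⟨v, hv, rfl⟩, hvR⟩ := habove (R + 3)
  rw [V_eq] at hv
  obtain ⟨d, hdR, hd⟩ := mem_closure_iff.1 hv.2 {z : Strip | R + 3 < z.1}
    (isOpen_lt continuous_const continuous_fst) hvR
  obtain ⟨δ, hδ, hδ0, hδ1, hδV⟩ := D_path hX hη hd
  obtain ⟨m, hm⟩ := (isCompact_range (continuous_fst.comp hδ)).bddBelow
  refine ⟨m - 3, fun γ hγ hR => ?_⟩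
  by_contra! hlt
  have h0 := V_top hX hη (hγ.2.2.2 0) hγ.2.2.1
  refine crossing (fun s => toC (δ s)) (fun t => toC (shiftPt 3 (γ t))) (toC_continuous.comp hδ)
    (toC_continuous.comp ((shift_continuous 3).comp hγ.1)) ?_ ?_ ?_ ?_ ?_ ?_
  · intro s t h
    exact V_shift hX hη (hδV s) (hγ.2.2.2 t) (toC_inj h)
  · intro t
    simp only [hδ0, toC_im, topP]
    exact (shiftPt 3 (γ t)).2.2.2
  · intro s
    have : ((shiftPt 3 (γ 0)).2 : ℝ) = 1 := hγ.2.2.1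
    simp only [toC_im, this]
    exact (δ s).2.2.2
  · simp only [hδ0, toC_re, topP, shiftPt]; push_cast; linarith
  · intro t
    have := hR t
    simp only [mem_ofPred_eq] at hdR
    simp only [hδ1, toC_re, shiftPt]; push_cast; linarith
  · intro s
    have : m ≤ (δ s).1 := hm ⟨s, rfl⟩
    simp only [toC_re, shiftPt]; push_cast; linarith

lemma keyB (hX : IsEAC X Um Up) (hη : etaSpec (pr ⁻¹' X) η)
    (hbelow : ¬ BddBelow (Prod.fst '' Vset (pr ⁻¹' Up) η)) (L : ℝ) :
    ∃ R0 : ℝ, ∀ γ : unitInterval → Strip, IsHair (Vset (pr ⁻¹' Up) η) γ →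
      (∀ t, L < (γ t).1) → (γ 1).1 ≤ R0 := by
  rw [not_bddBelow_iff] at hbelow
  obtain ⟨_, ⟨v, hv, rfl⟩, hvR⟩ := hbelow (L - 3)
  rw [V_eq] at hv
  obtain ⟨d, hdR, hd⟩ := mem_closure_iff.1 hv.2 {z : Strip | z.1 < L - 3}
    (isOpen_lt continuous_fst continuous_const) hvR
  obtain ⟨δ, hδ, hδ0, hδ1, hδV⟩ := D_path hX hη hd
  obtain ⟨m, hm⟩ := (isCompact_range (continuous_fst.comp hδ)).bddAbove
  refine ⟨m + 3, fun γ hγ hR => ?_⟩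
  by_contra! hlt
  have h0 := V_top hX hη (hγ.2.2.2 0) hγ.2.2.1
  let rf : Strip → Strip := fun z => (-z.1, z.2)
  have hrf : Continuous rf := by fun_prop
  have hri : ∀ z w, rf z = rf w → z = w := by
    intro z w h
    simp only [rf, Prod.mk.injEq, neg_inj] at h
    exact Prod.ext h.1 h.2
  refine crossing (fun s => toC (rf (δ s))) (fun t => toC (rf (shiftPt (-3) (γ t))))
    (toC_continuous.comp (hrf.comp hδ))
    (toC_continuous.comp (hrf.comp ((shift_continuous (-3)).comp hγ.1))) ?_ ?_ ?_ ?_ ?_ ?_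
  · intro s t h
    have h1 := hri _ _ (toC_inj h)
    refine V_shift hX hη (hγ.2.2.2 t) (hδV s) ?_
    rw [h1, shift_shift]
    norm_num [shift_zero]
  · intro t
    simp only [hδ0, toC_im, topP, rf]
    exact (shiftPt (-3) (γ t)).2.2.2
  · intro s
    have : ((shiftPt (-3) (γ 0)).2 : ℝ) = 1 := hγ.2.2.1
    simp only [toC_im, rf, this]
    exact (δ s).2.2.2
  · simp only [hδ0, toC_re, topP, shiftPt, rf]; push_cast; linarith
  · intro t
    have := hR t
    simp only [mem_ofPred_eq] at hdR
    simp only [hδ1, toC_re, shiftPt, rf]; push_cast; linarith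
  · intro s
    have : (δ s).1 ≤ m := hm ⟨s, rfl⟩
    simp only [toC_re, shiftPt, rf]; push_cast; linarith

lemma avoid_lt {γ : unitInterval → Strip} (hγ : Continuous γ) {R : ℝ} (h0 : (γ 0).1 < R)
    (hR : R ∉ proj1 γ) (t : unitInterval) : (γ t).1 < R := by
  by_contra! h
  have hp : IsPreconnected (proj1 γ) := isPreconnected_range (continuous_fst.comp hγ)
  exact hR (hp.ordConnected.out ⟨0, rfl⟩ ⟨t, rfl⟩ ⟨h0.le, h⟩)

lemma avoid_gt {γ : unitInterval → Strip} (hγ : Continuous γ) {R : ℝ} (h0 : R < (γ 0).1)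
    (hR : R ∉ proj1 γ) (t : unitInterval) : R < (γ t).1 := by
  by_contra! h
  have hp : IsPreconnected (proj1 γ) := isPreconnected_range (continuous_fst.comp hγ)
  exact hR (hp.ordConnected.out ⟨t, rfl⟩ ⟨0, rfl⟩ ⟨h, h0.le⟩)

end Sides

/-- Proposition: snake-like shape of `V`: if `(V)₁` is unbounded below and
above, there are sequences `Lₙ → −∞`, `Rₙ → +∞` controlling hairs of `V`. -/
theorem snake_shape
    (X Um Up : Set Ann) (hX : IsEAC X Um Up)
    (η : ℝ) (hη : etaSpec (pr ⁻¹' X) η)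
    (hbelow : ¬ BddBelow (Prod.fst '' Vset (pr ⁻¹' Up) η))
    (habove : ¬ BddAbove (Prod.fst '' Vset (pr ⁻¹' Up) η)) :
    ∃ L R : ℕ → ℝ,
      R 1 > 1 ∧ L 1 < 0 ∧
      (∀ n : ℕ, 1 ≤ n → L (n + 1) ≤ L n) ∧ Tendsto L atTop atBot ∧
      (∀ n : ℕ, 1 ≤ n → R n ≤ R (n + 1)) ∧ Tendsto R atTop atTop ∧
      (∀ n : ℕ, 1 ≤ n → ∀ γ : unitInterval → Strip,
        IsHair (Vset (pr ⁻¹' Up) η) γ → (γ 1).1 < L n → R n ∈ proj1 γ) ∧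
      (∀ n : ℕ, 2 ≤ n → ∀ γ : unitInterval → Strip,
        IsHair (Vset (pr ⁻¹' Up) η) γ → (γ 1).1 > R n → L (n - 1) ∈ proj1 γ) := by
  choose fA hA using keyA hX hη habove
  choose fB hB using keyB hX hη hbelow
  let p : ℕ → ℝ × ℝ := fun n => Nat.rec (min (-3) (fA 3), 3)
    (fun _ q => (min (q.1 - 1) (fA (max (q.2 + 1) (fB q.1))), max (q.2 + 1) (fB q.1))) n
  have hp0 : p 0 = (min (-3) (fA 3), 3) := rfl
  have hps : ∀ n, p (n + 1) = (min ((p n).1 - 1) (fA (max ((p n).2 + 1) (fB (p n).1))),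
      max ((p n).2 + 1) (fB (p n).1)) := fun n => rfl
  have hL1 : ∀ n, (p (n + 1)).1 ≤ (p n).1 - 1 := fun n => by rw [hps]; exact min_le_left _ _
  have hR1 : ∀ n, (p n).2 + 1 ≤ (p (n + 1)).2 := fun n => by rw [hps]; exact le_max_left _ _
  have hLA : ∀ n, (p n).1 ≤ fA (p n).2 := by
    intro n
    cases n with
    | zero => rw [hp0]; exact min_le_right _ _
    | succ n => rw [hps]; exact min_le_right _ _
  have hRB : ∀ n, fB (p n).1 ≤ (p (n + 1)).2 := fun n => by rw [hps]; exact le_max_right _ _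
  have hLn : ∀ n : ℕ, (p n).1 ≤ -3 - n := by
    intro n
    induction n with
    | zero => rw [hp0]; simp
    | succ n ih => push_cast; linarith [hL1 n]
  have hRn : ∀ n : ℕ, (3 : ℝ) + n ≤ (p n).2 := by
    intro n
    induction n with
    | zero => rw [hp0]; simp
    | succ n ih => push_cast; linarith [hR1 n]
  refine ⟨fun n => (p n).1, fun n => (p n).2, ?_, ?_, ?_, ?_, ?_, ?_, ?_, ?_⟩
  · have := hRn 1; push_cast at this; linarith
  · have := hLn 1; push_cast at this; linarith
  · intro n _; linarith [hL1 n]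
  · have h : Tendsto (fun n : ℕ => -(n : ℝ)) atTop atBot :=
      tendsto_neg_atTop_atBot.comp tendsto_natCast_atTop_atTop
    exact tendsto_atBot_mono (fun n => by linarith [hLn n]) h
  · intro n _; linarith [hR1 n]
  · refine tendsto_atTop_mono (f := fun n : ℕ => (n : ℝ)) (fun n => by linarith [hRn n]) ?_
    exact tendsto_natCast_atTop_atTop
  · intro n _ γ hγ hlt
    by_contra hcon
    have h0 := V_top hX hη (hγ.2.2.2 0) hγ.2.2.1
    have hn : (0 : ℝ) ≤ n := n.cast_nonneg
    have := hA (p n).2 γ hγ (avoid_lt hγ.1 (by linarith [hRn n]) hcon)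
    linarith [hLA n]
  · intro n hn2 γ hγ hgt
    obtain ⟨n, rfl⟩ : ∃ m, n = m + 1 := ⟨n - 1, by omega⟩
    by_contra hcon
    have h0 := V_top hX hη (hγ.2.2.2 0) hγ.2.2.1
    have hn : (0 : ℝ) ≤ n := n.cast_nonneg
    have := hB (p n).1 γ hγ (avoid_gt hγ.1 (by linarith [hLn n]) hcon)
    linarith [hRB n]
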